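/- Let Λ be a noetherian commutative local ring and let 𝒞 be an abelian category which is Λ-linear (each Hom-set Hom_𝒞(X, Y) carries a Λ-module structure with respect to which composition is Λ-bilinear) and locally finite over Λ (each Hom_𝒞(X, Y) is a finitely generated Λ-module). Let A and C be objects of 𝒞 with Hom_𝒞(A, C) = 0. Suppose given two short exact sequences 0 → A →^α B →^β C → 0 and 0 → A →^γ B' →^δ C → 0, morphisms â, b̂ : A → A, φ̃ : B → B', ψ̃ : B' → B, and isomorphisms φ, ψ : C → C such that (â, φ̃, φ) is a morphism of short exact sequences from the first to the second (i.e., φ̃∘α = γ∘â and δ∘φ̃ = φ∘β) and (b̂, ψ̃, ψ) is a morphism of short exact sequences from the second to the first (i.e., ψ̃∘γ = α∘b̂ and β∘ψ̃ = ψ∘δ). Then there exist isomorphisms â' : A → A and φ̃' : B → B' such that φ̃'∘α = γ∘â' and δ∘φ̃' = φ∘β; in particular φ̃' : B ≅ B' is an isomorphism lifting φ. -/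

import Mathlib

open CategoryTheory CategoryTheory.Limits

/-- Left stable range one, in the form used to replace a coefficient by a unit. -/
def LeftStableRangeOne (R : Type*) [Ring R] : Prop :=
  ∀ a c : R, ∃ t : R, IsUnit (a + t * (1 - c * a))

namespace LeftStableRangeOne

theorem of_ringEquiv {R S : Type*} [Ring R] [Ring S] (e : R ≃+* S)
    (hS : LeftStableRangeOne S) : LeftStableRangeOne R := by
  intro a c
  obtain ⟨t, ht⟩ := hS (e a) (e c)
  refine ⟨e.symm t, ?_⟩
  have := ht.map e.symm
  simpa using this

theorem pi {ι : Type*} {R : ι → Type*} [∀ i, Ring (R i)]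
    (h : ∀ i, LeftStableRangeOne (R i)) : LeftStableRangeOne (∀ i, R i) := by
  intro a c
  choose t ht using fun i ↦ h i (a i) (c i)
  exact ⟨t, Pi.isUnit_iff.mpr ht⟩

theorem moduleEnd (D V : Type*) [DivisionRing D] [AddCommGroup V] [Module D V]
    [FiniteDimensional D V] : LeftStableRangeOne (Module.End D V) := by
  intro a c
  obtain ⟨X, hX⟩ := (LinearMap.ker a).exists_isCompl
  obtain ⟨W, hW⟩ := (LinearMap.range a).exists_isCompl
  have hdim : Module.finrank D (LinearMap.ker a) = Module.finrank D W := by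
    have h1 := a.finrank_range_add_finrank_ker
    have h2 := Submodule.finrank_add_eq_of_isCompl hW
    omega
  let e := LinearEquiv.ofFinrankEq _ _ hdim
  let p := (LinearMap.ker a).projectionOnto X hX
  let t : Module.End D V := W.subtype ∘ₗ e.toLinearMap ∘ₗ p
  refine ⟨t, ?_⟩
  have hinj : Function.Injective (a + t * (1 - c * a) : Module.End D V) := by
    rw [← LinearMap.ker_eq_bot, LinearMap.ker_eq_bot']
    intro x hx
    have hx' : a x + t (x - c (a x)) = 0 := hx
    have hax : a x = 0 := by
      refine Submodule.disjoint_def.mp hW.disjoint _ ⟨x, rfl⟩ ?_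
      rw [eq_neg_of_add_eq_zero_left hx']
      exact W.neg_mem (e (p _)).2
    have htx : t x = 0 := by simpa [hax] using hx'
    have hpx : p x = ⟨x, hax⟩ := Submodule.projectionOnto_apply_left hX ⟨x, hax⟩
    have : e ⟨x, hax⟩ = 0 := by
      rw [← hpx]
      exact Subtype.ext htx
    exact congrArg Subtype.val (e.map_eq_zero_iff.mp this)
  exact (Module.End.isUnit_iff _).mpr ⟨hinj, LinearMap.injective_iff_surjective.mp hinj⟩

theorem matrix (n D : Type*) [Fintype n] [DecidableEq n] [DivisionRing D] :
    LeftStableRangeOne (Matrix n n D) :=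
  have : Module.Finite Dᵐᵒᵖ D :=
    .of_surjective (LinearMap.toSpanSingleton Dᵐᵒᵖ D 1) fun x ↦ ⟨.op x, by simp⟩
  of_ringEquiv ((RingEquiv.moduleEndSelfOp D).mapMatrix.trans
    (endVecRingEquivMatrixEnd n Dᵐᵒᵖ D).symm) (moduleEnd Dᵐᵒᵖ (n → D))

theorem of_isSemisimpleRing (R : Type*) [Ring R] [IsSemisimpleRing R] :
    LeftStableRangeOne R := by
  obtain ⟨n, D, d, _, _, ⟨e⟩⟩ := IsSemisimpleRing.exists_ringEquiv_pi_matrix_divisionRing R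
  exact of_ringEquiv e (pi fun i ↦ matrix _ _)

end LeftStableRangeOne

theorem Ring.isUnit_of_sub_one_mem_jacobson {R : Type*} [Ring R] {x : R}
    (hx : x - 1 ∈ Ring.jacobson R) : IsUnit x := by
  have key : ∀ y : R, y - 1 ∈ Ring.jacobson R → ∃ z, z * y = 1 := by
    intro y hy
    rw [← Ideal.jacobson_bot, Ideal.mem_jacobson_iff] at hy
    obtain ⟨z, hz⟩ := hy 1
    refine ⟨z, ?_⟩
    rw [Ideal.mem_bot] at hz
    have : z * 1 * (y - 1) + z - 1 = z * y - 1 := by noncomm_ring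
    rwa [this, sub_eq_zero] at hz
  obtain ⟨z, hz⟩ := key x hx
  have hz1 : z - 1 ∈ Ring.jacobson R := by
    have : z - 1 = -(z * (x - 1)) := by rw [mul_sub, hz]; simp
    rw [this]
    exact neg_mem (Ideal.mul_mem_left _ z hx)
  obtain ⟨w, hw⟩ := key z hz1
  have hwx : w = x := left_inv_eq_right_inv hw hz
  exact ⟨⟨x, z, hwx ▸ hw, hz⟩, rfl⟩

theorem Ring.isUnit_of_isUnit_mk_jacobson {R : Type*} [Ring R] {x : R}
    (hx : IsUnit (Ideal.Quotient.mk (Ring.jacobson R) x)) : IsUnit x := by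
  obtain ⟨b, h1, h2⟩ := isUnit_iff_exists.mp hx
  obtain ⟨b, rfl⟩ := Ideal.Quotient.mk_surjective b
  rw [← map_mul, ← map_one (Ideal.Quotient.mk (Ring.jacobson R)), Ideal.Quotient.eq] at h1 h2
  obtain ⟨u, hu⟩ := isUnit_of_sub_one_mem_jacobson h1
  obtain ⟨v, hv⟩ := isUnit_of_sub_one_mem_jacobson h2
  have hr : x * (b * ↑u⁻¹) = 1 := by rw [← mul_assoc, ← hu, Units.mul_inv]
  have hl : (↑v⁻¹ * b) * x = 1 := by rw [mul_assoc, ← hv, Units.inv_mul]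
  exact isUnit_iff_exists.mpr ⟨_, hr, left_inv_eq_right_inv hl hr ▸ hl⟩

theorem IsLocalRing.algebraMap_mem_jacobson (Λ R : Type*) [CommRing Λ] [IsLocalRing Λ] [Ring R]
    [Algebra Λ R] [Module.Finite Λ R]
    {x : Λ} (hx : x ∈ IsLocalRing.maximalIdeal Λ) :
    algebraMap Λ R x ∈ Ring.jacobson R := by
  rw [← Ideal.jacobson_bot, Ideal.mem_jacobson_iff]
  intro y
  have htop : (⊤ : Submodule Λ R) ≤ LinearMap.range (LinearMap.mulRight Λ (1 + x • y)) := by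
    refine Submodule.le_of_le_smul_of_le_jacobson_bot Module.Finite.fg_top
      (IsLocalRing.maximalIdeal_le_jacobson _) ?_
    intro r _
    refine Submodule.mem_sup.mpr ⟨r * (1 + x • y), ⟨r, rfl⟩, -(x • (r * y)),
      neg_mem (Submodule.smul_mem_smul hx trivial), ?_⟩
    simp [mul_add]
  obtain ⟨z, hz⟩ := htop (Submodule.mem_top (x := 1))
  refine ⟨z, ?_⟩
  have hz' : z * (1 + x • y) = 1 := hz
  rw [Ideal.mem_bot, mul_assoc, ← Algebra.commutes, ← Algebra.smul_def, sub_eq_zero, ← hz',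
    mul_add, mul_one, add_comm]

theorem IsLocalRing.isSemisimpleRing_quotient_jacobson (Λ R : Type*) [CommRing Λ] [IsLocalRing Λ] [Ring R]
    [Algebra Λ R] [Module.Finite Λ R] :
    IsSemisimpleRing (R ⧸ Ring.jacobson R) := by
  let m := IsLocalRing.maximalIdeal Λ
  have : IsArtinianRing (Λ ⧸ m) := inferInstanceAs (IsArtinianRing (IsLocalRing.ResidueField Λ))
  have : IsArtinian Λ (R ⧸ (m • ⊤ : Submodule Λ R)) :=
    isArtinian_of_surjective_algebraMap (R := Λ ⧸ m) Ideal.Quotient.mk_surjective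
  have hle : (m • ⊤ : Submodule Λ R) ≤ (Ring.jacobson R).restrictScalars Λ := by
    rw [Submodule.smul_le]
    intro x hx r _
    rw [Algebra.smul_def, Algebra.commutes]
    exact Ideal.mul_mem_left _ r (IsLocalRing.algebraMap_mem_jacobson Λ R hx)
  let π : R →ₗ[Λ] R ⧸ Ring.jacobson R := (Ring.jacobson R).mkQ.restrictScalars Λ
  have hπ : (m • ⊤ : Submodule Λ R) ≤ LinearMap.ker π := fun r hr ↦
    (Submodule.Quotient.mk_eq_zero _).mpr (hle hr)
  have : IsArtinian Λ (R ⧸ Ring.jacobson R) :=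
    isArtinian_of_surjective _ (Submodule.liftQ _ π hπ) fun y ↦ by
      obtain ⟨r, rfl⟩ := Submodule.mkQ_surjective _ y
      exact ⟨Submodule.Quotient.mk r, rfl⟩
  have : IsArtinianRing (R ⧸ Ring.jacobson R) := isArtinian_of_tower Λ this
  exact IsArtinianRing.isSemisimpleRing_iff_jacobson.mpr (Ring.jacobson_quotient_jacobson R)

theorem LeftStableRangeOne.of_finite_isLocalRing (Λ R : Type*) [CommRing Λ] [IsLocalRing Λ] [Ring R]
    [Algebra Λ R] [Module.Finite Λ R] : LeftStableRangeOne R := by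
  have := IsLocalRing.isSemisimpleRing_quotient_jacobson Λ R
  intro a c
  obtain ⟨t, ht⟩ := LeftStableRangeOne.of_isSemisimpleRing (R ⧸ Ring.jacobson R)
    (Ideal.Quotient.mk _ a) (Ideal.Quotient.mk _ c)
  obtain ⟨t, rfl⟩ := Ideal.Quotient.mk_surjective t
  exact ⟨t, Ring.isUnit_of_isUnit_mk_jacobson (by simpa using ht)⟩

theorem Subalgebra.mem_of_mul_eq_one_of_isNoetherian {Λ H : Type*} [CommRing Λ] [Ring H]
    [Algebra Λ H] [IsNoetherian Λ H] (T : Subalgebra Λ H) {u v : H} (hu : u ∈ T)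
    (huv : u * v = 1) : v ∈ T := by
  let M : ℕ →o Submodule Λ H :=
    ⟨fun n ↦ (Subalgebra.toSubmodule T).comap (LinearMap.mulLeft Λ (u ^ n)),
      monotone_nat_of_le_succ fun n h hh ↦ by
        have : u * (u ^ n * h) ∈ T := T.mul_mem hu hh
        simpa [pow_succ', mul_assoc] using this⟩
  have hpow : ∀ n, u ^ n * v ^ n = 1 := fun n ↦ by
    induction n with
    | zero => simp
    | succ n ih => rw [pow_succ, pow_succ', mul_assoc, ← mul_assoc u, huv, one_mul, ih]
  obtain ⟨n, hn⟩ := monotone_stabilizes_iff_noetherian.mpr ‹_› M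
  have h1 : v ^ (n + 1) ∈ M (n + 1) := by
    change u ^ (n + 1) * v ^ (n + 1) ∈ T
    rw [hpow]
    exact T.one_mem
  rw [← hn (n + 1) n.le_succ] at h1
  have h2 : u ^ n * v ^ (n + 1) ∈ T := h1
  rwa [pow_succ, ← mul_assoc, hpow, one_mul] at h2

namespace CategoryTheory

/-- The endomorphisms of the target of `β` that lift along `β`. -/
def liftableEnd (Λ : Type*) [CommRing Λ] {𝒞 : Type*} [Category 𝒞] [Preadditive 𝒞] [Linear Λ 𝒞]
    {B C : 𝒞} (β : B ⟶ C) : Subalgebra Λ (End C) where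
  carrier := {h | ∃ p : B ⟶ B, p ≫ β = β ≫ (show C ⟶ C from h)}
  mul_mem' := by
    rintro a b ⟨p, hp⟩ ⟨q, hq⟩
    refine ⟨q ≫ p, ?_⟩
    change _ = β ≫ (b ≫ a)
    rw [Category.assoc, hp, reassoc_of% hq]
  add_mem' := by
    rintro a b ⟨p, hp⟩ ⟨q, hq⟩
    refine ⟨p + q, ?_⟩
    change _ = β ≫ (a + b)
    rw [Preadditive.add_comp, hp, hq, Preadditive.comp_add]
  algebraMap_mem' r := by
    refine ⟨r • 𝟙 B, ?_⟩
    change _ = β ≫ (r • 𝟙 C)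
    simp

end CategoryTheory

/-- In an abelian category linear and locally finite over a noetherian commutative local
ring `Λ`, given objects `A`, `C` with `Hom(A, C) = 0`, two short exact sequences
`0 → A → B → C → 0` and `0 → A → B' → C → 0`, a morphism of short exact sequences
`(â, φ̃, φ)` from the first to the second and a morphism `(b̂, ψ̃, ψ)` from the second to
the first, where `φ` and `ψ` are isomorphisms, there exist isomorphisms `â' : A ≅ A` and
`φ̃' : B ≅ B'` with `φ̃'∘α = γ∘â'` and `δ∘φ̃' = φ∘β`. -/
theorem stmt_5 (Λ : Type*) [CommRing Λ] [IsNoetherianRing Λ] [IsLocalRing Λ]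
    {𝒞 : Type*} [Category 𝒞] [Abelian 𝒞] [Linear Λ 𝒞]
    (hfin : ∀ X Y : 𝒞, Module.Finite Λ (X ⟶ Y))
    {A B B' C : 𝒞} (hAC : ∀ f : A ⟶ C, f = 0)
    (α : A ⟶ B) (β : B ⟶ C) (w : α ≫ β = 0)
    (hS : (ShortComplex.mk α β w).ShortExact)
    (γ : A ⟶ B') (δ : B' ⟶ C) (w' : γ ≫ δ = 0)
    (hS' : (ShortComplex.mk γ δ w').ShortExact)
    (ahat bhat : A ⟶ A) (φt : B ⟶ B') (ψt : B' ⟶ B) (φ ψ : C ⟶ C)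
    (hφ : IsIso φ) (hψ : IsIso ψ)
    (h1 : α ≫ φt = ahat ≫ γ) (h2 : φt ≫ δ = β ≫ φ)
    (h3 : γ ≫ ψt = bhat ≫ α) (h4 : ψt ≫ β = δ ≫ ψ) :
    ∃ (ahat' : A ⟶ A) (φt' : B ⟶ B'), IsIso ahat' ∧ IsIso φt' ∧
      α ≫ φt' = ahat' ≫ γ ∧ φt' ≫ δ = β ≫ φ := by
  have : Mono α := hS.mono_f
  have : Module.Finite Λ (End A) := hfin A A
  have : Module.Finite Λ (End C) := hfin C C
  have hθ : (φ ≫ ψ : C ⟶ C) ∈ liftableEnd Λ β := ⟨φt ≫ ψt, by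
    rw [Category.assoc, h4, reassoc_of% h2]⟩
  obtain ⟨p, hp⟩ : ∃ p : B ⟶ B, p ≫ β = β ≫ inv (φ ≫ ψ) :=
    Subalgebra.mem_of_mul_eq_one_of_isNoetherian (liftableEnd Λ β) hθ
      (show inv (φ ≫ ψ) ≫ (φ ≫ ψ) = 𝟙 C by simp)
  have hχ : (ψt ≫ p) ≫ β = δ ≫ inv φ := by
    rw [Category.assoc, hp, reassoc_of% h4]
    simp
  obtain ⟨c, hc⟩ : ∃ c : A ⟶ A, c ≫ α = γ ≫ ψt ≫ p :=
    hS.exact.lift' (γ ≫ ψt ≫ p) (by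
      change (γ ≫ ψt ≫ p) ≫ β = 0
      rw [Category.assoc, hχ, reassoc_of% w', zero_comp])
  obtain ⟨s, hs⟩ : ∃ s : B ⟶ A, s ≫ α = 𝟙 B - φt ≫ ψt ≫ p :=
    hS.exact.lift' (𝟙 B - φt ≫ ψt ≫ p) (by
      change (𝟙 B - φt ≫ ψt ≫ p) ≫ β = 0
      rw [Preadditive.sub_comp, Category.assoc, hχ, reassoc_of% h2]
      simp)
  have hαs : α ≫ s = 𝟙 A - ahat ≫ c := by
    rw [← cancel_mono α]
    simp [hs, hc, reassoc_of% h1]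
  obtain ⟨t, ht⟩ : ∃ t : A ⟶ A, IsIso (ahat + (𝟙 A - ahat ≫ c) ≫ t) := by
    obtain ⟨t, ht⟩ := LeftStableRangeOne.of_finite_isLocalRing Λ (End A) ahat c
    exact ⟨t, (isUnit_iff_isIso _).mp ht⟩
  have e1 : α ≫ (φt + s ≫ t ≫ γ) = (ahat + (𝟙 A - ahat ≫ c) ≫ t) ≫ γ := by
    rw [Preadditive.comp_add, h1, reassoc_of% hαs, Preadditive.add_comp, Category.assoc]
  have e2 : (φt + s ≫ t ≫ γ) ≫ δ = β ≫ φ := by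
    simp [h2, w']
  let F : ShortComplex.mk α β w ⟶ ShortComplex.mk γ δ w' :=
    ⟨ahat + (𝟙 A - ahat ≫ c) ≫ t, φt + s ≫ t ≫ γ, φ, e1.symm, e2⟩
  have : IsIso F.τ₁ := ht
  have : IsIso F.τ₃ := hφ
  exact ⟨_, _, ht, ShortComplex.isIso₂_of_shortExact_of_isIso₁₃ F hS hS', e1, e2⟩
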